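/- Let n ≥ 1, let Ω ⊆ ℝⁿ be an open set, x₀ ∈ ℝⁿ, λ > 0, and let f : ℝⁿ → ℝ be a smooth function with compact support contained in Ω. Then ∫_Ω (|x−x₀|²/(8λ)) |f(x)|² e^{−|x−x₀|²/(4λ)} dx ≤ 2λ ∫_Ω |∇f(x)|² e^{−|x−x₀|²/(4λ)} dx + (n/2) ∫_Ω |f(x)|² e^{−|x−x₀|²/(4λ)} dx. -/

import Mathlib

open MeasureTheory Real

/-- The integral of a directional derivative of a compactly supported `C¹` function vanishes. -/
theorem integral_fderiv_apply_eq_zero {n : ℕ} {h : EuclideanSpace ℝ (Fin n) → ℝ}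
    (hh : ContDiff ℝ 1 h) (hsupp : HasCompactSupport h) (v : EuclideanSpace ℝ (Fin n)) :
    ∫ x, fderiv ℝ h x v = 0 := by
  have hint : Integrable (fun x => fderiv ℝ h x v) :=
    ((hh.continuous_fderiv one_ne_zero).clm_apply continuous_const).integrable_of_hasCompactSupport
      (hsupp.fderiv_apply ℝ v)
  have key := integral_mul_fderiv_eq_neg_fderiv_mul_of_integrable (𝕜 := ℝ) (μ := volume)
    (f := fun _ : EuclideanSpace ℝ (Fin n) => (1 : ℝ)) (g := h) (v := v)
    (by simp) (by simpa using hint)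
    (by simpa using hh.continuous.integrable_of_hasCompactSupport hsupp)
    (by fun_prop) (fun x _ => (hh.differentiable one_ne_zero) x)
  simpa using key

/-- Derivative along the `i`-th basis vector of the `i`-th component of the vector field
`f² e^{-|x - x₀|²/(4λ)} (x - x₀)`. -/
theorem fderiv_sq_mul_gaussian_mul_coord {n : ℕ} {f : EuclideanSpace ℝ (Fin n) → ℝ}
    (hf : Differentiable ℝ f) (x₀ x : EuclideanSpace ℝ (Fin n)) {lam : ℝ} (hlam : lam ≠ 0)
    (i : Fin n) :
    fderiv ℝ (fun x => f x ^ 2 * Real.exp (-‖x - x₀‖ ^ 2 / (4 * lam)) * (x - x₀) i) x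
        (EuclideanSpace.single i 1) =
      (2 * f x * ((x - x₀) i * fderiv ℝ f x (EuclideanSpace.single i 1)) + f x ^ 2
        - f x ^ 2 * (x - x₀) i ^ 2 / (2 * lam)) * Real.exp (-‖x - x₀‖ ^ 2 / (4 * lam)) := by
  have hsub : HasFDerivAt (fun x => x - x₀) (ContinuousLinearMap.id ℝ _) x :=
    (hasFDerivAt_id x).sub_const x₀
  have hexp := ((hsub.norm_sq.neg).mul_const (4 * lam)⁻¹).exp
  have hcoord := (EuclideanSpace.proj i : EuclideanSpace ℝ (Fin n) →L[ℝ] ℝ).hasFDerivAt.comp x hsub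
  have key := ((((hf x).hasFDerivAt.pow 2).mul hexp).mul hcoord).fderiv
  simp only [div_eq_mul_inv]
  refine (DFunLike.congr_fun key (EuclideanSpace.single i (1 : ℝ))).trans ?_
  simp [EuclideanSpace.inner_single_right]
  field_simp
  ring

/-- inequality (2.21), weighted Poincaré/Hardy-type inequality: for smooth `f`
compactly supported in `Ω`,
`∫_Ω (|x−x₀|²/(8λ)) f² e^{−|x−x₀|²/(4λ)} dx
  ≤ 2λ ∫_Ω |∇f|² e^{−|x−x₀|²/(4λ)} dx + (n/2) ∫_Ω f² e^{−|x−x₀|²/(4λ)} dx`. -/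
theorem weighted_poincare
    {n : ℕ} (hn : 1 ≤ n) (Ω : Set (EuclideanSpace ℝ (Fin n))) (hΩopen : IsOpen Ω)
    (x₀ : EuclideanSpace ℝ (Fin n)) (lam : ℝ) (hlam : 0 < lam)
    (f : EuclideanSpace ℝ (Fin n) → ℝ)
    (hf : ContDiff ℝ (⊤ : ℕ∞) f) (hsupp : HasCompactSupport f) (hsub : tsupport f ⊆ Ω) :
    (∫ x in Ω, ‖x - x₀‖^2 / (8 * lam) * (f x)^2 * Real.exp (-‖x - x₀‖^2 / (4 * lam))) ≤
      2 * lam * (∫ x in Ω, ‖gradient f x‖^2 * Real.exp (-‖x - x₀‖^2 / (4 * lam))) +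
        (n:ℝ)/2 * ∫ x in Ω, (f x)^2 * Real.exp (-‖x - x₀‖^2 / (4 * lam)) := by
  have hf1 : ContDiff ℝ 1 f := hf.of_le (by exact_mod_cast le_top)
  have hgrad_cont : Continuous (gradient f) :=
    (InnerProductSpace.toDual ℝ _).symm.continuous.comp (hf1.continuous_fderiv one_ne_zero)
  have hf_zero : ∀ x, x ∉ tsupport f → f x = 0 := fun x hx => image_eq_zero_of_notMem_tsupport hx
  have hgrad_zero : ∀ x, x ∉ tsupport f → gradient f x = 0 := fun x hx => by
    have hx' : fderiv ℝ f x = 0 := by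
      by_contra hne
      exact hx (support_fderiv_subset ℝ hne)
    simp [gradient, hx']
  have hint : ∀ {g : EuclideanSpace ℝ (Fin n) → ℝ}, Continuous g →
      (∀ x, x ∉ tsupport f → g x = 0) → Integrable g := fun hg hg0 =>
    hg.integrable_of_hasCompactSupport (HasCompactSupport.intro hsupp hg0)
  set G : EuclideanSpace ℝ (Fin n) → ℝ := fun x => Real.exp (-‖x - x₀‖ ^ 2 / (4 * lam)) with hG
  have hG_smooth : ContDiff ℝ 1 G :=
    ((((contDiff_id.sub contDiff_const).norm_sq ℝ).neg).div_const _).exp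
  have hG_cont := hG_smooth.continuous
  have hf_cont := hf1.continuous
  set h : Fin n → EuclideanSpace ℝ (Fin n) → ℝ := fun i x => f x ^ 2 * G x * (x - x₀) i with hh
  have hh_smooth : ∀ i, ContDiff ℝ 1 (h i) := fun i =>
    ((hf1.pow 2).mul hG_smooth).mul
      ((EuclideanSpace.proj i : EuclideanSpace ℝ (Fin n) →L[ℝ] ℝ).contDiff.comp
        (contDiff_id.sub contDiff_const))
  have hh_supp : ∀ i, HasCompactSupport (h i) := fun i =>
    HasCompactSupport.intro hsupp fun x hx => by simp [hh, hf_zero x hx]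
  have hdiv_int : ∀ i, Integrable (fun x => fderiv ℝ (h i) x (EuclideanSpace.single i 1)) :=
    fun i => (((hh_smooth i).continuous_fderiv one_ne_zero).clm_apply
      continuous_const).integrable_of_hasCompactSupport ((hh_supp i).fderiv_apply ℝ _)
  have hdiv_zero : ∫ x, ∑ i, fderiv ℝ (h i) x (EuclideanSpace.single i 1) = 0 := by
    rw [integral_finsetSum _ fun i _ => hdiv_int i]
    exact Finset.sum_eq_zero fun i _ =>
      integral_fderiv_apply_eq_zero (hh_smooth i) (hh_supp i) _
  have hdiv : ∀ x, ∑ i, fderiv ℝ (h i) x (EuclideanSpace.single i 1) =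
      (2 * f x * inner ℝ (gradient f x) (x - x₀) + n * f x ^ 2
        - f x ^ 2 * ‖x - x₀‖ ^ 2 / (2 * lam)) * G x := fun x => by
    have hinner : inner ℝ (gradient f x) (x - x₀) =
        ∑ i, (x - x₀) i * fderiv ℝ f x (EuclideanSpace.single i 1) := by
      rw [gradient, InnerProductSpace.toDual_symm_apply]
      conv_lhs => rw [← (EuclideanSpace.basisFun (Fin n) ℝ).sum_repr (x - x₀)]
      simp [-PiLp.sub_apply]
    rw [Finset.sum_congr rfl fun i _ =>
      fderiv_sq_mul_gaussian_mul_coord (hf1.differentiable one_ne_zero) x₀ x hlam.ne' i,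
      ← Finset.sum_mul, Finset.sum_sub_distrib, Finset.sum_add_distrib, ← Finset.mul_sum,
      ← Finset.sum_div, ← Finset.mul_sum, ← hinner, ← EuclideanSpace.real_norm_sq_eq]
    simp [hG]
  have hpoint : ∀ x, ‖x - x₀‖ ^ 2 / (8 * lam) * f x ^ 2 * G x
        + 1 / 2 * ∑ i, fderiv ℝ (h i) x (EuclideanSpace.single i 1) ≤
      2 * lam * (‖gradient f x‖ ^ 2 * G x) + n / 2 * (f x ^ 2 * G x) := fun x => by
    have hCS : f x * inner ℝ (gradient f x) (x - x₀) ≤ |f x| * (‖gradient f x‖ * ‖x - x₀‖) :=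
      (le_abs_self _).trans (by rw [abs_mul]; gcongr; exact abs_real_inner_le_norm _ _)
    have hyoung : |f x| * (‖gradient f x‖ * ‖x - x₀‖) ≤
        2 * lam * ‖gradient f x‖ ^ 2 + ‖x - x₀‖ ^ 2 / (8 * lam) * f x ^ 2 := by
      have hsq : 0 ≤ (4 * lam * ‖gradient f x‖ - |f x| * ‖x - x₀‖) ^ 2 / (8 * lam) := by positivity
      have hexpand : (4 * lam * ‖gradient f x‖ - |f x| * ‖x - x₀‖) ^ 2 / (8 * lam) =
          2 * lam * ‖gradient f x‖ ^ 2 + ‖x - x₀‖ ^ 2 / (8 * lam) * f x ^ 2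
            - |f x| * (‖gradient f x‖ * ‖x - x₀‖) := by
        rw [← sq_abs (f x)]
        field_simp
        ring
      linarith
    have hmul := mul_le_mul_of_nonneg_right (hCS.trans hyoung) (Real.exp_pos _ : 0 < G x).le
    have hquarter : f x ^ 2 * ‖x - x₀‖ ^ 2 / (2 * lam) =
        4 * (‖x - x₀‖ ^ 2 / (8 * lam) * f x ^ 2) := by
      field_simp
      ring
    rw [hdiv, hquarter]
    linarith
  have hA : Integrable fun x => ‖x - x₀‖ ^ 2 / (8 * lam) * f x ^ 2 * G x :=
    hint (by fun_prop) fun x hx => by simp [hf_zero x hx]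
  have hB : Integrable fun x => ‖gradient f x‖ ^ 2 * G x :=
    hint (by fun_prop) fun x hx => by simp [hgrad_zero x hx]
  have hC : Integrable fun x => f x ^ 2 * G x :=
    hint (by fun_prop) fun x hx => by simp [hf_zero x hx]
  have hD := integrable_finsetSum Finset.univ fun i _ => hdiv_int i
  have hmono := integral_mono (hA.add (hD.const_mul (1 / 2)))
    ((hB.const_mul (2 * lam)).add (hC.const_mul ((n : ℝ) / 2))) hpoint
  simp only [Pi.add_apply] at hmono
  rw [integral_add hA (hD.const_mul _), integral_add (hB.const_mul _) (hC.const_mul _),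
    integral_const_mul, integral_const_mul, integral_const_mul, hdiv_zero, mul_zero,
    add_zero] at hmono
  rwa [setIntegral_eq_integral_of_forall_compl_eq_zero fun x hx => by
      simp [hf_zero x fun hx' => hx (hsub hx')],
    setIntegral_eq_integral_of_forall_compl_eq_zero fun x hx => by
      simp [hgrad_zero x fun hx' => hx (hsub hx')],
    setIntegral_eq_integral_of_forall_compl_eq_zero fun x hx => by
      simp [hf_zero x fun hx' => hx (hsub hx')]]
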